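/- Let A, B, C, D be points in the plane such that the segments [A,B] and [C,D] are disjoint. Then ∠ADB + ∠DBC + ∠BCA + ∠CAD = 0, where each angle ∠XYZ has vertex Y (all these angles are defined, since disjointness of the segments implies D ∉ {A,B}, B ∉ {C,D}, C ∉ {A,B}, A ∉ {C,D}). -/

import Mathlib

/-- The oriented angle `∠XYZ ∈ (−π, π]` with vertex `Y`: `oangle Y X Z = arg ((Z − Y)/(X − Y))`. -/
noncomputable def oangle (Y X Z : ℂ) : ℝ := Complex.arg ((Z - Y) / (X - Y))

theorem Complex.arg_div_of_re_pos {x y : ℂ} (hx : 0 < x.re) (hy : 0 < y.re) :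
    (y / x).arg = y.arg - x.arg := by
  have hx0 : x ≠ 0 := by rintro rfl; simp at hx
  have hy0 : y ≠ 0 := by rintro rfl; simp at hy
  have hax := abs_lt.1 (Complex.abs_arg_lt_pi_div_two_iff.2 (Or.inl hx))
  have hay := abs_lt.1 (Complex.abs_arg_lt_pi_div_two_iff.2 (Or.inl hy))
  have hinv : x⁻¹.arg = -x.arg := by
    rw [Complex.arg_inv, if_neg]
    linarith [Real.pi_pos]
  rw [div_eq_mul_inv, Complex.arg_mul hy0 (inv_ne_zero hx0), hinv, sub_eq_add_neg]
  rw [hinv]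
  constructor <;> linarith

theorem Complex.arg_div_of_re_mul_pos {u x y : ℂ} (hx : 0 < (u * x).re) (hy : 0 < (u * y).re) :
    (y / x).arg = (u * y).arg - (u * x).arg := by
  have hu : u ≠ 0 := by rintro rfl; simp at hx
  rw [← Complex.arg_div_of_re_pos hx hy, mul_div_mul_left _ _ hu]

theorem exists_re_mul_sub_pos {s t : Set ℂ} (hs : Convex ℝ s) (hsc : IsCompact s)
    (ht : Convex ℝ t) (htc : IsClosed t) (h : Disjoint s t) :
    ∃ u : ℂ, ∀ x ∈ s, ∀ y ∈ t, 0 < (u * (x - y)).re := by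
  obtain ⟨f, a, b, hfs, hab, hft⟩ := geometric_hahn_banach_compact_closed hs hsc ht htc h
  have hf : ∀ z, f z = z.re * f 1 + z.im * f Complex.I := fun z ↦ by
    conv_lhs => rw [show z = z.re • (1 : ℂ) + z.im • Complex.I by simp]
    simp only [map_add, map_smul, smul_eq_mul]
  refine ⟨⟨-f 1, f Complex.I⟩, fun x hx y hy ↦ ?_⟩
  have h₁ := hfs x hx
  have h₂ := hft y hy
  rw [hf] at h₁ h₂
  simp only [Complex.mul_re, Complex.sub_re, Complex.sub_im]
  linarith

theorem isCompact_segment_complex (x y : ℂ) : IsCompact (segment ℝ x y) := by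
  rw [segment_eq_image]
  exact isCompact_Icc.image (by fun_prop)

theorem stmt19 (A B C D : ℂ)
    (h : Disjoint (segment ℝ A B) (segment ℝ C D)) :
    oangle D A B + oangle B D C + oangle C B A + oangle A C D = 0 := by
  obtain ⟨u, hu⟩ := exists_re_mul_sub_pos (convex_segment A B) (isCompact_segment_complex A B)
    (convex_segment C D) (isCompact_segment_complex C D).isClosed h
  have hAC := hu A (left_mem_segment ℝ A B) C (left_mem_segment ℝ C D)
  have hAD := hu A (left_mem_segment ℝ A B) D (right_mem_segment ℝ C D)
  have hBC := hu B (right_mem_segment ℝ A B) C (left_mem_segment ℝ C D)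
  have hBD := hu B (right_mem_segment ℝ A B) D (right_mem_segment ℝ C D)
  have hB : (C - B) / (D - B) = (B - C) / (B - D) := by
    rw [← neg_sub B C, ← neg_sub B D, neg_div_neg_eq]
  have hA : (D - A) / (C - A) = (A - D) / (A - C) := by
    rw [← neg_sub A C, ← neg_sub A D, neg_div_neg_eq]
  simp only [oangle]
  rw [hA, hB, Complex.arg_div_of_re_mul_pos hAD hBD, Complex.arg_div_of_re_mul_pos hBD hBC,
    Complex.arg_div_of_re_mul_pos hBC hAC, Complex.arg_div_of_re_mul_pos hAC hAD]
  ring
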